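/- Let A generate a C₀-group {U(t)} on a Banach space X satisfying the non-quasianalyticity condition ∫_{-∞}^∞ ln‖U(t)‖/(1+t²) dt < ∞. Then for every k ∈ ℕ there is a constant m_k > 0 such that for all x ∈ X and r ≥ 1, the best approximation E_r(x,A) = inf{‖x−y‖ : y ∈ 𝔈(A), σ(y,A) ≤ r} by exponential type entire vectors of type at most r satisfies E_r(x,A) ≤ m_k · ω̃_k(1/r, x, A). -/

import Mathlib

open Filter Topology MeasureTheory

variable {X : Type*} [NormedAddCommGroup X] [NormedSpace ℝ X] [CompleteSpace X]

/-- `M_U(t) = sup_{|τ| ≤ t} ‖U(τ)‖`. -/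
noncomputable def groupBound (U : ℝ → X →L[ℝ] X) (t : ℝ) : ℝ :=
  sSup {a : ℝ | ∃ τ : ℝ, |τ| ≤ t ∧ a = ‖U τ‖}

/-- `ω_k(t,x) = sup_{0 ≤ τ ≤ t} ‖(U(τ)-I)^k x‖`, the k-th modulus of continuity. -/
noncomputable def modulus (U : ℝ → X →L[ℝ] X) (k : ℕ) (t : ℝ) (x : X) : ℝ :=
  sSup {a : ℝ | ∃ τ : ℝ, 0 ≤ τ ∧ τ ≤ t ∧ a = ‖((U τ - 1) ^ k) x‖}

/-- `ω̃_k(t,x) = sup_{|τ| ≤ t} ‖(U(τ)-I)^k x‖`, the symmetric modulus of continuity. -/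
noncomputable def symModulus (U : ℝ → X →L[ℝ] X) (k : ℕ) (t : ℝ) (x : X) : ℝ :=
  sSup {a : ℝ | ∃ τ : ℝ, |τ| ≤ t ∧ a = ‖((U τ - 1) ^ k) x‖}

/-- `U` is a `C₀`-group of bounded operators. -/
structure IsC0Group (U : ℝ → X →L[ℝ] X) : Prop where
  map_zero : U 0 = 1
  map_add : ∀ s t : ℝ, U (s + t) = U s ∘L U t
  cont : ∀ x : X, Continuous fun t : ℝ => U t x

/-- The chain relation `A (xs n) = xs (n+1)` for the generator `A` of the group `U`,
expressed via `d/ds U(s) xs n = U(s) (xs (n+1))`. -/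
def GenChain (U : ℝ → X →L[ℝ] X) (xs : ℕ → X) : Prop :=
  ∀ (n : ℕ) (s : ℝ), HasDerivAt (fun t : ℝ => U t (xs n)) (U s (xs (n + 1))) s

/-- `y` is an entire vector of exponential type ≤ r for the generator of `U`:
`σ(y,A) = limsup ‖Aⁿy‖^{1/n} ≤ r`. -/
def ExpTypeLe (U : ℝ → X →L[ℝ] X) (y : X) (r : ℝ) : Prop :=
  ∃ xs : ℕ → X, xs 0 = y ∧ GenChain U xs ∧
    ∀ ρ : ℝ, r < ρ → ∃ c : ℝ, 0 < c ∧ ∀ n : ℕ, ‖xs n‖ ≤ c * ρ ^ n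

/-- `E_r(x,A)`: the best approximation of `x` by exponential type entire vectors
of type at most `r`. -/
noncomputable def bestApprox (U : ℝ → X →L[ℝ] X) (x : X) (r : ℝ) : ℝ :=
  sInf {d : ℝ | ∃ y : X, ExpTypeLe U y r ∧ d = ‖x - y‖}

set_option linter.unusedSectionVars false

/-- `f` has derivatives at `t` growing at most like `α ^ n * F`. -/
def JetBound (f : ℝ → ℝ) (α F t : ℝ) : Prop :=
  ∀ n : ℕ, |iteratedDeriv n f t| ≤ α ^ n * F

theorem JetBound.mul {f g : ℝ → ℝ} {α β F G t : ℝ} (hf : ContDiff ℝ (⊤ : ℕ∞) f)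
    (hg : ContDiff ℝ (⊤ : ℕ∞) g) (hF : JetBound f α F t) (hG : JetBound g β G t) :
    JetBound (fun s => f s * g s) (α + β) (F * G) t := by
  intro n
  have hle : ((n : ℕ∞) : WithTop ℕ∞) ≤ ((⊤ : ℕ∞) : WithTop ℕ∞) := by exact_mod_cast le_top
  have hf' : ContDiffAt ℝ n f t := (hf.of_le hle).contDiffAt
  have hg' : ContDiffAt ℝ n g t := (hg.of_le hle).contDiffAt
  rw [iteratedDeriv_fun_mul hf' hg']
  calc _ ≤ ∑ i ∈ Finset.range (n + 1),
        |(n.choose i : ℝ) * iteratedDeriv i f t * iteratedDeriv (n - i) g t| :=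
        Finset.abs_sum_le_sum_abs _ _
    _ ≤ ∑ i ∈ Finset.range (n + 1),
        (n.choose i : ℝ) * ((α ^ i * F) * (β ^ (n - i) * G)) := by
        refine Finset.sum_le_sum fun i _ => ?_
        rw [abs_mul, abs_mul, Nat.abs_cast, mul_assoc]
        have := mul_le_mul (hF i) (hG (n - i)) (abs_nonneg _) ((abs_nonneg _).trans (hF i))
        gcongr
    _ = (α + β) ^ n * (F * G) := by
        rw [add_pow, Finset.sum_mul]
        exact Finset.sum_congr rfl fun i _ => by ring

theorem JetBound.one (t : ℝ) : JetBound (fun _ => 1) 0 1 t := by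
  intro n
  rw [iteratedDeriv_const]
  rcases n with _ | n <;> simp

theorem JetBound.pow {f : ℝ → ℝ} {α F t : ℝ} (hf : ContDiff ℝ (⊤ : ℕ∞) f)
    (hF : JetBound f α F t) (q : ℕ) : JetBound (fun s => f s ^ q) (q * α) (F ^ q) t := by
  induction q with
  | zero => simpa using JetBound.one t
  | succ q ih =>
    have := JetBound.mul (hf.pow q) hf ih hF
    simpa only [pow_succ, Nat.cast_succ, add_mul, one_mul] using this

theorem JetBound.prod_range {f : ℕ → ℝ → ℝ} {b F : ℕ → ℝ} {t : ℝ}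
    (hf : ∀ m, ContDiff ℝ (⊤ : ℕ∞) (f m)) (hF : ∀ m, JetBound (f m) (b m) (F m) t) (N : ℕ) :
    JetBound (fun s => ∏ m ∈ Finset.range N, f m s) (∑ m ∈ Finset.range N, b m)
      (∏ m ∈ Finset.range N, F m) t := by
  induction N with
  | zero => simpa using JetBound.one t
  | succ N ih =>
    simp only [Finset.prod_range_succ, Finset.sum_range_succ]
    exact JetBound.mul (contDiff_prod fun m _ => hf m) (hf N) ih (hF N)

theorem JetBound.comp_const_mul {f : ℝ → ℝ} {α F t a : ℝ} (hf : ContDiff ℝ (⊤ : ℕ∞) f)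
    (ha : 0 ≤ a) (hF : JetBound f α F (a * t)) : JetBound (fun s => f (a * s)) (a * α) F t := by
  intro n
  have hle : ((n : ℕ∞) : WithTop ℕ∞) ≤ ((⊤ : ℕ∞) : WithTop ℕ∞) := by exact_mod_cast le_top
  rw [iteratedDeriv_comp_const_mul (hf.of_le hle), abs_mul, abs_of_nonneg (pow_nonneg ha n),
    mul_pow, mul_assoc]
  exact mul_le_mul_of_nonneg_left (hF n) (pow_nonneg ha n)

theorem JetBound.nonneg {f : ℝ → ℝ} {α F t : ℝ} (h : JetBound f α F t) : 0 ≤ F := by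
  simpa using (abs_nonneg _).trans (h 0)

theorem JetBound.mono {f : ℝ → ℝ} {α β F G t : ℝ} (h : JetBound f α F t) (hα : 0 ≤ α)
    (hαβ : α ≤ β) (hFG : F ≤ G) : JetBound f β G t := fun n =>
  (h n).trans (mul_le_mul (pow_le_pow_left₀ hα hαβ n) hFG h.nonneg
    (pow_nonneg (hα.trans hαβ) n))

/-- A sequence of functions each of which is the derivative of the previous one consists of the
iterated derivatives of its first term. -/
theorem iteratedDeriv_of_chain {h : ℕ → ℝ → ℝ}
    (hh : ∀ n t, HasDerivAt (h n) (h (n + 1) t) t) (n : ℕ) : iteratedDeriv n (h 0) = h n := by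
  induction n with
  | zero => exact iteratedDeriv_zero
  | succ n ih =>
    rw [iteratedDeriv_succ, ih]
    exact funext fun t => (hh n t).deriv

theorem contDiff_of_chain {h : ℕ → ℝ → ℝ}
    (hh : ∀ n t, HasDerivAt (h n) (h (n + 1) t) t) : ContDiff ℝ (⊤ : ℕ∞) (h 0) := by
  refine contDiff_of_differentiable_iteratedDeriv fun m _ => ?_
  rw [iteratedDeriv_of_chain hh]
  exact fun t => (hh m t).differentiableAt

/-- The `n`-th derivative of the cardinal sine. -/
noncomputable def sincDeriv (n : ℕ) (t : ℝ) : ℝ :=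
  ∫ s in (0 : ℝ)..1, s ^ n * Real.cos (s * t + n * (Real.pi / 2))

theorem hasDerivAt_sincDeriv (n : ℕ) (t : ℝ) :
    HasDerivAt (sincDeriv n) (sincDeriv (n + 1) t) t := by
  refine (intervalIntegral.hasDerivAt_integral_of_dominated_loc_of_deriv_le
    (μ := volume) (a := 0) (b := 1) (s := Set.univ) (x₀ := t) (bound := fun _ => 1)
    (F := fun t s => s ^ n * Real.cos (s * t + n * (Real.pi / 2)))
    (F' := fun t s => s ^ (n + 1) * Real.cos (s * t + (n + 1 : ℕ) * (Real.pi / 2)))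
    univ_mem ?_ ?_ ?_ ?_ ?_ ?_).2
  · exact Eventually.of_forall fun x => Continuous.aestronglyMeasurable (by fun_prop)
  · exact Continuous.intervalIntegrable (by fun_prop) _ _
  · exact Continuous.aestronglyMeasurable (by fun_prop)
  · refine Eventually.of_forall fun s hs x _ => ?_
    rw [Set.uIoc_of_le zero_le_one] at hs
    rw [Real.norm_eq_abs, abs_mul, abs_of_nonneg (pow_nonneg hs.1.le _)]
    exact mul_le_one₀ (pow_le_one₀ hs.1.le hs.2) (abs_nonneg _) (Real.abs_cos_le_one _)
  · exact intervalIntegrable_const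
  · refine Eventually.of_forall fun s _ x _ => ?_
    have h1 : HasDerivAt (fun x : ℝ => s * x + n * (Real.pi / 2)) s x := by
      simpa using ((hasDerivAt_id x).const_mul s).add_const (n * (Real.pi / 2))
    have h2 := (h1.cos).const_mul (s ^ n)
    refine h2.congr_deriv ?_
    rw [show s * x + ((n + 1 : ℕ) : ℝ) * (Real.pi / 2)
      = (s * x + n * (Real.pi / 2)) + Real.pi / 2 by push_cast; ring, Real.cos_add_pi_div_two]
    ring

theorem abs_sincDeriv_le_one (n : ℕ) (t : ℝ) : |sincDeriv n t| ≤ 1 := by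
  have := intervalIntegral.norm_integral_le_of_norm_le_const (a := (0 : ℝ)) (b := 1) (C := 1)
    (f := fun s => s ^ n * Real.cos (s * t + n * (Real.pi / 2))) (fun s hs => by
      rw [Set.uIoc_of_le zero_le_one] at hs
      rw [Real.norm_eq_abs, abs_mul, abs_of_nonneg (pow_nonneg hs.1.le _)]
      exact mul_le_one₀ (pow_le_one₀ hs.1.le hs.2) (abs_nonneg _) (Real.abs_cos_le_one _))
  simpa [sincDeriv] using this

theorem abs_sincDeriv_le_div (n : ℕ) {t : ℝ} (ht : t ≠ 0) : |sincDeriv n t| ≤ 2 / |t| := by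
  have hv : ∀ s : ℝ, HasDerivAt (fun s => Real.sin (s * t + n * (Real.pi / 2)) / t)
      (Real.cos (s * t + n * (Real.pi / 2))) s := by
    intro s
    have h1 : HasDerivAt (fun s : ℝ => s * t + n * (Real.pi / 2)) t s := by
      simpa using ((hasDerivAt_id s).mul_const t).add_const (n * (Real.pi / 2))
    have h2 := h1.sin.div_const t
    rwa [mul_div_cancel_right₀ _ ht] at h2
  have hparts := intervalIntegral.integral_mul_deriv_eq_deriv_mul (a := (0 : ℝ)) (b := 1)
    (fun s _ => hasDerivAt_pow n s) (fun s _ => hv s)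
    (Continuous.intervalIntegrable (by fun_prop) _ _)
    (Continuous.intervalIntegrable (by fun_prop) _ _)
  have hsin : ∀ x : ℝ, |Real.sin x / t| ≤ 1 / |t| := fun x => by
    rw [abs_div]; gcongr; exact Real.abs_sin_le_one x
  rw [sincDeriv, hparts]
  have hInt : |∫ s in (0 : ℝ)..1, ↑n * s ^ (n - 1) * (Real.sin (s * t + n * (Real.pi / 2)) / t)|
      ≤ (1 - 0 ^ n) * (1 / |t|) := by
    calc _ ≤ ∫ s in (0 : ℝ)..1, ↑n * s ^ (n - 1) * (1 / |t|) := by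
          rw [← Real.norm_eq_abs]
          refine intervalIntegral.norm_integral_le_of_norm_le zero_le_one
            (Eventually.of_forall fun s hs => ?_)
            (Continuous.intervalIntegrable (by fun_prop) _ _)
          rw [Real.norm_eq_abs, abs_mul, abs_of_nonneg
            (mul_nonneg (Nat.cast_nonneg n) (pow_nonneg hs.1.le (n - 1)))]
          exact mul_le_mul_of_nonneg_left (hsin _)
            (mul_nonneg (Nat.cast_nonneg n) (pow_nonneg hs.1.le (n - 1)))
      _ = (1 - 0 ^ n) * (1 / |t|) := by
          rw [intervalIntegral.integral_mul_const,
            intervalIntegral.integral_eq_sub_of_hasDerivAt (fun s _ => hasDerivAt_pow n s)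
              (Continuous.intervalIntegrable (by fun_prop) _ _), one_pow]
  have h1 := hsin (1 * t + n * (Real.pi / 2))
  have h0 := hsin (0 * t + n * (Real.pi / 2))
  have hpos : (0 : ℝ) ≤ 0 ^ n := pow_nonneg le_rfl n
  calc _ ≤ |1 ^ n * (Real.sin (1 * t + n * (Real.pi / 2)) / t)|
        + |0 ^ n * (Real.sin (0 * t + n * (Real.pi / 2)) / t)| + (1 - 0 ^ n) * (1 / |t|) :=
        (abs_sub _ _).trans (add_le_add (abs_sub _ _) hInt)
    _ ≤ 1 / |t| + 0 ^ n * (1 / |t|) + (1 - 0 ^ n) * (1 / |t|) := by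
        rw [one_pow, one_mul, abs_mul, abs_of_nonneg hpos]
        gcongr
    _ = 2 / |t| := by ring

theorem sincDeriv_zero_zero : sincDeriv 0 0 = 1 := by simp [sincDeriv]

/-- Infinite products of smooth functions with summable exponential types. -/
theorem exists_infinite_prod {f : ℕ → ℝ → ℝ} {b : ℕ → ℝ} {F : ℕ → ℝ → ℝ} {B : ℝ}
    (hf : ∀ m, ContDiff ℝ (⊤ : ℕ∞) (f m)) (hF : ∀ m t, JetBound (f m) (b m) (F m t) t)
    (hF1 : ∀ m t, F m t ≤ 1) (hf0 : ∀ m, f m 0 = 1) (hb : ∀ m, 0 ≤ b m) (hbs : Summable b)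
    (hB : ∑' m, b m ≤ B) (hB1 : B ≤ 1) :
    ∃ g : ℝ → ℝ, ContDiff ℝ (⊤ : ℕ∞) g ∧ g 0 = 1 ∧ (∀ t, JetBound g B 1 t) ∧
      ∀ m t, JetBound g B (F m t) t := by
  have hB0 : 0 ≤ B := (tsum_nonneg hb).trans hB
  have hsum : ∀ N, ∑ m ∈ Finset.range N, b m ≤ B := fun N =>
    (hbs.sum_le_tsum _ fun m _ => hb m).trans hB
  have hb1 : ∀ m, b m ≤ 1 := fun m => ((hbs.le_tsum m fun j _ => hb j).trans hB).trans hB1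
  set G : ℕ → ℝ → ℝ := fun N s => ∏ m ∈ Finset.range N, f m s with hG
  have hGs : ∀ N, ContDiff ℝ (⊤ : ℕ∞) (G N) := fun N => contDiff_prod fun m _ => hf m
  have hFn : ∀ m t, 0 ≤ F m t := fun m t => (hF m t).nonneg
  have hG1 : ∀ N t, JetBound (G N) B 1 t := fun N t =>
    (JetBound.prod_range hf (fun m => hF m t) N).mono (Finset.sum_nonneg fun m _ => hb m)
      (hsum N) (Finset.prod_le_one (fun m _ => hFn m t) fun m _ => hF1 m t)
  have hGF : ∀ m t N, m < N → JetBound (G N) B (F m t) t := fun m t N hmN =>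
    (JetBound.prod_range hf (fun m => hF m t) N).mono (Finset.sum_nonneg fun m _ => hb m)
      (hsum N) (by
        rw [← Finset.mul_prod_erase _ _ (Finset.mem_range.2 hmN)]
        exact mul_le_of_le_one_right (hFn m t)
          (Finset.prod_le_one (fun m _ => hFn m t) fun m _ => hF1 m t))
  have hle : ∀ n : ℕ, ((n : ℕ∞) : WithTop ℕ∞) ≤ ((⊤ : ℕ∞) : WithTop ℕ∞) := fun n => by
    exact_mod_cast le_top
  have hq : ∀ N t, JetBound (fun s => f N s - 1) 1 (b N * (1 + |t|)) t := by
    intro N t n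
    rw [one_pow, one_mul]
    rcases n with _ | n
    · have := Convex.norm_image_sub_le_of_norm_deriv_le (𝕜 := ℝ) (f := f N) (s := Set.univ)
        (x := 0) (y := t) (C := b N)
        (fun x _ => (hf N).differentiable (by simp) x)
        (fun x _ => by
          have := hF N x 1
          rw [iteratedDeriv_one, pow_one] at this
          exact this.trans (mul_le_of_le_one_right (hb N) (hF1 N x)))
        convex_univ trivial trivial
      rw [hf0, sub_zero, Real.norm_eq_abs, Real.norm_eq_abs] at this
      rw [iteratedDeriv_zero]
      nlinarith [hb N]
    · have hsub : iteratedDeriv (n + 1) (fun s => f N s - 1) t = iteratedDeriv (n + 1) (f N) t := by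
        rw [iteratedDeriv_fun_sub ((hf N).of_le (hle _)).contDiffAt contDiffAt_const,
          iteratedDeriv_const]
        simp
      rw [hsub]
      refine (hF N t (n + 1)).trans ?_
      rw [pow_succ']
      calc b N * b N ^ n * F N t ≤ b N * 1 * 1 := by
            gcongr
            · exact hFn N t
            · exact mul_nonneg (hb N) zero_le_one
            · exact hb N
            · exact pow_le_one₀ (hb N) (hb1 N)
            · exact hF1 N t
        _ ≤ b N * (1 + |t|) := by nlinarith [hb N, abs_nonneg t]
  set d : ℕ → ℝ → ℝ := fun N s => G N s * (f N s - 1) with hd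
  have hds : ∀ N, ContDiff ℝ (⊤ : ℕ∞) (d N) := fun N => (hGs N).mul ((hf N).sub contDiff_const)
  have hdb : ∀ N t, JetBound (d N) (B + 1) (b N * (1 + |t|)) t := fun N t => by
    simpa using JetBound.mul (hGs N) ((hf N).sub contDiff_const) (hG1 N t) (hq N t)
  have hdG : ∀ N, d N = G (N + 1) - G N := fun N => by
    funext s
    simp only [hd, hG, Finset.prod_range_succ, Pi.sub_apply]
    ring
  have hsummable : ∀ n t, Summable fun N => iteratedDeriv n (d N) t := fun n t =>
    Summable.of_norm_bounded ((hbs.mul_right (1 + |t|)).mul_left ((B + 1) ^ n))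
      fun N => hdb N t n
  set h : ℕ → ℝ → ℝ := fun n t =>
    iteratedDeriv n (G 0) t + ∑' N, iteratedDeriv n (d N) t with hh
  have hderiv : ∀ (φ : ℝ → ℝ), ContDiff ℝ (⊤ : ℕ∞) φ → ∀ n t,
      HasDerivAt (iteratedDeriv n φ) (iteratedDeriv (n + 1) φ t) t := fun φ hφ n t => by
    rw [iteratedDeriv_succ]
    exact ((hφ.differentiable_iteratedDeriv n (by exact_mod_cast ENat.natCast_lt_top n)) t).hasDerivAt
  have hchain : ∀ n t, HasDerivAt (h n) (h (n + 1) t) t := by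
    intro n t
    refine (hderiv _ (hGs 0) n t).add ?_
    refine hasDerivAt_tsum_of_isPreconnected (u := fun N => (B + 1) ^ (n + 1) *
      (b N * (1 + (|t| + 1)))) (t := Metric.ball 0 (|t| + 1)) (y₀ := t)
      ((hbs.mul_right _).mul_left _) Metric.isOpen_ball (convex_ball _ _).isPreconnected
      (fun N y _ => hderiv _ (hds N) n y) (fun N y hy => ?_) (by simp) (hsummable n t) (by simp)
    rw [mem_ball_zero_iff, Real.norm_eq_abs] at hy
    refine (hdb N y (n + 1)).trans ?_
    have := hb N
    gcongr
  have hlim : ∀ n t, Tendsto (fun N => iteratedDeriv n (G N) t) atTop (𝓝 (h n t)) := by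
    intro n t
    have hs : ∀ N, iteratedDeriv n (G 0) t + ∑ m ∈ Finset.range N, iteratedDeriv n (d m) t
        = iteratedDeriv n (G N) t := by
      intro N
      induction N with
      | zero => simp
      | succ N ih =>
        rw [Finset.sum_range_succ, ← add_assoc, ih, hdG,
          iteratedDeriv_sub ((hGs _).of_le (hle n)).contDiffAt ((hGs _).of_le (hle n)).contDiffAt]
        ring
    refine Tendsto.congr hs ?_
    exact ((hsummable n t).hasSum.tendsto_sum_nat).const_add _
  have hid := iteratedDeriv_of_chain hchain
  refine ⟨h 0, contDiff_of_chain hchain, ?_, fun t n => ?_, fun m t n => ?_⟩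
  · refine tendsto_nhds_unique (hlim 0 0) ?_
    have h1 : ∀ N, iteratedDeriv 0 (G N) 0 = 1 := fun N => by
      rw [iteratedDeriv_zero]
      exact Finset.prod_eq_one fun m _ => hf0 m
    exact tendsto_const_nhds.congr fun N => (h1 N).symm
  · rw [hid]
    exact le_of_tendsto (hlim n t).abs (Eventually.of_forall fun N => hG1 N t n)
  · rw [hid]
    refine le_of_tendsto (hlim n t).abs ?_
    filter_upwards [eventually_gt_atTop m] with N hN using hGF m t N hN n

/-- The least `m` with `|t| ≤ 2 ^ m`. -/
noncomputable def dyadicIndex (t : ℝ) : ℕ := Nat.clog 2 ⌈|t|⌉₊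

theorem abs_le_two_pow_dyadicIndex (t : ℝ) : |t| ≤ 2 ^ dyadicIndex t := by
  refine (Nat.le_ceil _).trans ?_
  exact_mod_cast Nat.le_pow_clog one_lt_two ⌈|t|⌉₊

theorem two_pow_lt_of_dyadicIndex_eq {t : ℝ} {m : ℕ} (h : dyadicIndex t = m + 1) :
    (2 : ℝ) ^ m < |t| := by
  have hc : 1 < ⌈|t|⌉₊ := by
    by_contra hle
    rw [dyadicIndex, Nat.clog_of_right_le_one (not_lt.1 hle)] at h
    exact absurd h (by simp)
  have := Nat.pow_pred_clog_lt_self one_lt_two hc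
  rw [dyadicIndex] at h
  rw [h, Nat.pred_succ, Nat.lt_ceil] at this
  exact_mod_cast this

theorem one_add_sq_le_four_pow (t : ℝ) : 1 + t ^ 2 ≤ 4 ^ (dyadicIndex t + 1) := by
  have h := pow_le_pow_left₀ (abs_nonneg t) (abs_le_two_pow_dyadicIndex t) 2
  rw [sq_abs, ← pow_mul, mul_comm, pow_mul] at h
  have h1 : (1 : ℝ) ≤ 4 ^ dyadicIndex t := one_le_pow₀ (by norm_num)
  rw [pow_succ (4 : ℝ)]
  norm_num at h
  linarith

theorem exp_neg_two_mul_le (t : ℝ) :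
    Real.exp (-(2 * (dyadicIndex t + 1 : ℝ))) ≤ (1 + t ^ 2)⁻¹ := by
  rw [Real.exp_neg]
  refine inv_anti₀ (by positivity) ((one_add_sq_le_four_pow t).trans ?_)
  have h2 : (2 : ℝ) ≤ Real.exp 1 := by linarith [Real.add_one_le_exp (1 : ℝ)]
  calc (4 : ℝ) ^ (dyadicIndex t + 1) = 2 ^ (2 * (dyadicIndex t + 1)) := by
        rw [pow_mul]; norm_num
    _ ≤ Real.exp 1 ^ (2 * (dyadicIndex t + 1)) := by gcongr
    _ = _ := by rw [← Real.exp_nat_mul]; push_cast; ring_nf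

theorem contDiff_sincDeriv_zero : ContDiff ℝ (⊤ : ℕ∞) (sincDeriv 0) :=
  contDiff_of_chain hasDerivAt_sincDeriv

open Classical in
theorem jetBound_sincDeriv (m : ℕ) (t : ℝ) :
    JetBound (fun s => sincDeriv 0 (6 / 2 ^ m * s)) (6 / 2 ^ m)
      (if (2 : ℝ) ^ m ≤ |t| then Real.exp (-1) else 1) t := by
  have ha : (0 : ℝ) ≤ 6 / 2 ^ m := by positivity
  suffices h : JetBound (sincDeriv 0) 1 (if (2 : ℝ) ^ m ≤ |t| then Real.exp (-1) else 1)
      (6 / 2 ^ m * t) by simpa using h.comp_const_mul contDiff_sincDeriv_zero ha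
  intro n
  rw [iteratedDeriv_of_chain hasDerivAt_sincDeriv, one_pow, one_mul]
  split_ifs with ht
  · have hp : (0 : ℝ) < 2 ^ m := by positivity
    have habs : 6 ≤ |6 / 2 ^ m * t| := by
      rw [abs_mul, abs_of_nonneg ha, div_mul_eq_mul_div, le_div_iff₀ hp]
      linarith
    refine (abs_sincDeriv_le_div n (abs_pos.1 (by linarith))).trans ?_
    calc 2 / |6 / 2 ^ m * t| ≤ 2 / 6 := by gcongr
      _ ≤ (Real.exp 1)⁻¹ := by
        rw [le_inv_comm₀ (by norm_num) (Real.exp_pos 1)]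
        linarith [Real.exp_one_lt_d9]
      _ = Real.exp (-1) := (Real.exp_neg 1).symm
  · exact abs_sincDeriv_le_one n _

open Classical in
/-- Band-limited functions with prescribed non-quasianalytic decay. -/
theorem exists_jetBound_decay {q : ℕ → ℕ} (hq : Summable fun m => (q m : ℝ) / 2 ^ m) :
    ∃ g : ℝ → ℝ, ∃ C : ℝ, ContDiff ℝ (⊤ : ℕ∞) g ∧ g 0 = 1 ∧ (∀ t, JetBound g (1 / 2) 1 t) ∧
      ∀ t, JetBound g (1 / 2) (C * Real.exp (-(q (dyadicIndex t) : ℝ))) t := by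
  set b : ℕ → ℝ := fun m => q (m + 1) * (6 / 2 ^ m) with hbdef
  have hb0 : ∀ m, 0 ≤ b m := fun m => by positivity
  have hbs : Summable b := by
    refine (((summable_nat_add_iff 1).2 hq).mul_left 12).congr fun m => ?_
    simp only [hbdef, pow_succ]
    field_simp
    ring
  obtain ⟨M, hM⟩ := ((tendsto_sum_nat_add b).eventually
    (ge_mem_nhds (by norm_num : (0 : ℝ) < 1 / 2))).exists
  have hpow : ∀ (j : ℕ) (t : ℝ), (if (2 : ℝ) ^ (j + M) ≤ |t| then Real.exp (-1) else 1) ^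
      q (j + M + 1) = if (2 : ℝ) ^ (j + M) ≤ |t| then Real.exp (-(q (j + M + 1) : ℝ)) else 1 := by
    intro j t
    split_ifs
    · rw [← Real.exp_nat_mul]; ring_nf
    · exact one_pow _
  have hsm : ∀ m : ℕ, ContDiff ℝ (⊤ : ℕ∞) fun s => sincDeriv 0 (6 / 2 ^ m * s) := fun m =>
    contDiff_sincDeriv_zero.comp (contDiff_const.mul contDiff_id)
  obtain ⟨g, hg, hg0, hg1, hgF⟩ := exists_infinite_prod
    (f := fun j s => sincDeriv 0 (6 / 2 ^ (j + M) * s) ^ q (j + M + 1)) (b := fun j => b (j + M))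
    (F := fun j t => if (2 : ℝ) ^ (j + M) ≤ |t| then Real.exp (-(q (j + M + 1) : ℝ)) else 1)
    (B := 1 / 2) (fun j => (hsm (j + M)).pow _)
    (fun j t => by
      have := (jetBound_sincDeriv (j + M) t).pow (hsm (j + M)) (q (j + M + 1))
      rwa [hpow] at this)
    (fun j t => by
      split_ifs
      · exact Real.exp_le_one_iff.2 (by simp)
      · exact le_rfl)
    (fun j => by simp [sincDeriv_zero_zero]) (fun j => hb0 _)
    ((summable_nat_add_iff M).2 hbs) hM (by norm_num)
  refine ⟨g, Real.exp (∑ m ∈ Finset.range (M + 1), (q m : ℝ)), hg, hg0, hg1, fun t => ?_⟩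
  have hS : (0 : ℝ) ≤ ∑ m ∈ Finset.range (M + 1), (q m : ℝ) :=
    Finset.sum_nonneg fun m _ => Nat.cast_nonneg _
  rw [← Real.exp_add]
  rcases Nat.lt_or_ge M (dyadicIndex t) with hlt | hge
  · obtain ⟨j, hj⟩ : ∃ j, dyadicIndex t = j + M + 1 :=
      ⟨dyadicIndex t - M - 1, by omega⟩
    have := hgF j t
    rw [if_pos (two_pow_lt_of_dyadicIndex_eq hj).le, ← hj] at this
    exact this.mono (by norm_num) le_rfl (Real.exp_le_exp.2 (by linarith))
  · refine (hg1 t).mono (by norm_num) le_rfl (Real.one_le_exp ?_)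
    have := Finset.single_le_sum (f := fun m => (q m : ℝ)) (fun m _ => Nat.cast_nonneg _)
      (Finset.mem_range.2 (Nat.lt_succ_of_le hge))
    linarith

/-- Existence of normalised averaging kernels of exponential type one with prescribed
non-quasianalytic decay of all derivatives. -/
theorem exists_kernel {q : ℕ → ℕ} (hq : Summable fun m => (q m : ℝ) / 2 ^ m)
    (hq2 : ∀ m, 2 * (m + 1) ≤ q m) :
    ∃ K : ℕ → ℝ → ℝ, ∃ C : ℝ, 0 < C ∧ (∀ n t, HasDerivAt (K n) (K (n + 1) t) t) ∧
      ∫ t, K 0 t = 1 ∧ ∀ n t, |K n t| ≤ C * Real.exp (-(q (dyadicIndex t) : ℝ)) := by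
  obtain ⟨g, C, hg, hg0, hg1, hgC⟩ := exists_jetBound_decay hq
  set k : ℝ → ℝ := fun t => g t * g t with hk
  have hks : ContDiff ℝ (⊤ : ℕ∞) k := hg.mul hg
  have hkb : ∀ n t, |iteratedDeriv n k t| ≤ C * Real.exp (-(q (dyadicIndex t) : ℝ)) := by
    intro n t
    have := JetBound.mul hg hg (hg1 t) (hgC t) n
    rwa [show (1 / 2 + 1 / 2 : ℝ) = 1 by norm_num, one_pow, one_mul, one_mul] at this
  have hC : 0 ≤ C := by
    have := (hgC 0).nonneg
    exact nonneg_of_mul_nonneg_left this (Real.exp_pos _)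
  have hdecay : ∀ t, Real.exp (-(q (dyadicIndex t) : ℝ)) ≤ (1 + t ^ 2)⁻¹ := fun t => by
    refine le_trans (Real.exp_le_exp.2 (neg_le_neg ?_)) (exp_neg_two_mul_le t)
    exact_mod_cast hq2 (dyadicIndex t)
  have hki : Integrable k := by
    refine (integrable_inv_one_add_sq.const_mul C).mono' hks.continuous.aestronglyMeasurable
      (Eventually.of_forall fun t => ?_)
    have := hkb 0 t
    rw [iteratedDeriv_zero] at this
    exact this.trans (mul_le_mul_of_nonneg_left (hdecay t) hC)
  have hI : 0 < ∫ t, k t := by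
    rw [integral_pos_iff_support_of_nonneg (fun t => mul_self_nonneg _) hki]
    exact (hks.continuous.isOpen_support).measure_pos _ ⟨0, by simp [hk, hg0]⟩
  refine ⟨fun n t => (∫ t, k t)⁻¹ * iteratedDeriv n k t, (∫ t, k t)⁻¹ * (C + 1),
    by positivity, fun n t => ?_, ?_, fun n t => ?_⟩
  · refine HasDerivAt.const_mul _ ?_
    rw [iteratedDeriv_succ]
    exact ((hks.differentiable_iteratedDeriv n
      (by exact_mod_cast ENat.natCast_lt_top n)) t).hasDerivAt
  · rw [integral_const_mul, iteratedDeriv_zero, inv_mul_cancel₀ hI.ne']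
  · rw [abs_mul, abs_of_pos (inv_pos.2 hI), mul_assoc]
    refine mul_le_mul_of_nonneg_left ((hkb n t).trans ?_) (inv_pos.2 hI).le
    exact mul_le_mul_of_nonneg_right (by linarith) (Real.exp_pos _).le

open Classical in
theorem sum_dyadic_tail_le {v : ℝ} (hv : 0 ≤ v) (N : ℕ) :
    ∑ m ∈ Finset.range N, (if v ≤ (4 : ℝ) ^ (m + 1) then ((4 : ℝ) ^ m)⁻¹ else 0)
      ≤ 20 / 3 / (1 + v) := by
  have htel : ∑ m ∈ Finset.range N, (if v ≤ (4 : ℝ) ^ (m + 1) then ((4 : ℝ) ^ m)⁻¹ else 0)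
      ≤ 16 / 3 / max 4 v - 16 / 3 / max (4 ^ (N + 1)) v := by
    induction N with
    | zero => simp
    | succ N ih =>
      rw [Finset.sum_range_succ]
      have hstep : (if v ≤ (4 : ℝ) ^ (N + 1) then ((4 : ℝ) ^ N)⁻¹ else 0) ≤
          16 / 3 / max ((4 : ℝ) ^ (N + 1)) v - 16 / 3 / max ((4 : ℝ) ^ (N + 1 + 1)) v := by
        have hp : (0 : ℝ) < 4 ^ N := by positivity
        split_ifs with h
        · have h' : v ≤ (4 : ℝ) ^ (N + 1 + 1) := h.trans
            (pow_le_pow_right₀ (by norm_num) (Nat.le_succ _))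
          rw [max_eq_left h, max_eq_left h', pow_succ, pow_succ]
          refine le_of_eq ?_
          field_simp
          ring
        · rw [sub_nonneg]
          gcongr
          · norm_num
          · exact Nat.le_succ _
      linarith
  have hpos : 0 ≤ 16 / 3 / max ((4 : ℝ) ^ (N + 1)) v := by positivity
  have hm : (0 : ℝ) < max 4 v := lt_max_of_lt_left (by norm_num)
  have hfin : 16 / 3 / max 4 v ≤ 20 / 3 / (1 + v) := by
    rw [div_le_div_iff₀ hm (by linarith)]
    linarith [le_max_left 4 v, le_max_right 4 v]
  linarith

/-- A nonnegative subadditive function that is integrable against `1 / (1 + t ^ 2)` has summable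
dyadic majorants. -/
theorem exists_dyadic_majorant {p : ℝ → ℝ} (hp0 : ∀ t, 0 ≤ p t)
    (hsub : ∀ s t, p (s + t) ≤ p s + p t) (hInt : Integrable fun t => p t / (1 + t ^ 2)) :
    ∃ L : ℕ → ℝ, (∀ m, 0 ≤ L m) ∧ (Summable fun m => L m / 2 ^ m) ∧
      ∀ m s, |s| ≤ 2 ^ m → p s ≤ L m := by
  have hne : ∀ t : ℝ, 1 + t ^ 2 ≠ 0 := fun t => by positivity
  have hpi : ∀ a b, IntervalIntegrable p volume a b := fun a b => by
    have h := (hInt.intervalIntegrable (a := a) (b := b)).mul_continuousOn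
      (g := fun t => 1 + t ^ 2) (by fun_prop)
    simpa only [div_mul_cancel₀ _ (hne _)] using h
  refine ⟨fun m => (∫ u in (-(2 * 2 ^ m) : ℝ)..2 * 2 ^ m, p u) / 2 ^ m, fun m => ?_, ?_,
    fun m s hs => ?_⟩
  · refine div_nonneg (intervalIntegral.integral_nonneg ?_ fun u _ => hp0 u) (by positivity)
    have : (0 : ℝ) < 2 ^ m := by positivity
    linarith
  · have hle : ∀ m : ℕ, (-(2 * 2 ^ m) : ℝ) ≤ 2 * 2 ^ m := fun m => by
      have : (0 : ℝ) < 2 ^ m := by positivity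
      linarith
    set I : ℕ → ℝ → ℝ := fun m => (Set.Ioc (-(2 * 2 ^ m) : ℝ) (2 * 2 ^ m)).indicator
      fun u => ((4 : ℝ) ^ m)⁻¹ * p u with hI
    have hII : ∀ m, Integrable (I m) := fun m =>
      IntegrableOn.integrable_indicator
        (((intervalIntegrable_iff_integrableOn_Ioc_of_le (hle m)).1 (hpi _ _)).const_mul _)
        measurableSet_Ioc
    have hterm : ∀ m : ℕ, (∫ u in (-(2 * 2 ^ m) : ℝ)..2 * 2 ^ m, p u) / 2 ^ m / 2 ^ m
        = ∫ u, I m u := by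
      intro m
      rw [hI, integral_indicator measurableSet_Ioc, integral_const_mul,
        intervalIntegral.integral_of_le (hle m), div_div, ← mul_pow, div_eq_inv_mul]
      norm_num
    simp only [hterm]
    have hI0 : ∀ m u, 0 ≤ I m u := fun m u =>
      Set.indicator_nonneg (fun u _ => mul_nonneg (by positivity) (hp0 u)) u
    refine summable_of_sum_range_le (c := ∫ u, 20 / 3 * (p u / (1 + u ^ 2)))
      (fun m => integral_nonneg (hI0 m)) fun N => ?_
    rw [← integral_finsetSum _ fun m _ => hII m]
    refine integral_mono (integrable_finsetSum _ fun m _ => hII m) (hInt.const_mul _) fun u => ?_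
    calc ∑ m ∈ Finset.range N, I m u
        ≤ ∑ m ∈ Finset.range N,
          (if u ^ 2 ≤ (4 : ℝ) ^ (m + 1) then ((4 : ℝ) ^ m)⁻¹ else 0) * p u := by
          refine Finset.sum_le_sum fun m _ => ?_
          by_cases hu : u ∈ Set.Ioc (-(2 * 2 ^ m) : ℝ) (2 * 2 ^ m)
          · have hu2 : u ^ 2 ≤ (4 : ℝ) ^ (m + 1) := by
              have h1 : |u| ≤ 2 * 2 ^ m := abs_le.2 ⟨hu.1.le, hu.2⟩
              have h2 := pow_le_pow_left₀ (abs_nonneg u) h1 2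
              rw [sq_abs, ← pow_succ', ← pow_mul, mul_comm, pow_mul] at h2
              norm_num at h2
              exact h2
            rw [if_pos hu2, hI]
            simp only [Set.indicator_of_mem hu, le_refl]
          · rw [hI]
            simp only [Set.indicator_of_notMem hu]
            refine mul_nonneg ?_ (hp0 u)
            split_ifs <;> positivity
      _ ≤ 20 / 3 / (1 + u ^ 2) * p u := by
          rw [← Finset.sum_mul]
          exact mul_le_mul_of_nonneg_right (sum_dyadic_tail_le (sq_nonneg u) N) (hp0 u)
      _ = 20 / 3 * (p u / (1 + u ^ 2)) := by ring
  · set T : ℝ := 2 ^ m with hT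
    have hT0 : 0 < T := by positivity
    obtain ⟨hs1, hs2⟩ := abs_le.1 hs
    have hcomp : IntervalIntegrable (fun u => p (s - u)) volume (-T) T := by
      have := (hpi (s - -T) (s - T)).comp_sub_left s
      simpa using this
    have h1 : ∫ _ in (-T)..T, p s ≤ ∫ u in (-T)..T, (p u + p (s - u)) := by
      refine intervalIntegral.integral_mono_on (by linarith) intervalIntegrable_const
        ((hpi _ _).add hcomp) fun u _ => ?_
      simpa using hsub u (s - u)
    rw [intervalIntegral.integral_add (hpi _ _) hcomp, intervalIntegral.integral_const,
      intervalIntegral.integral_comp_sub_left, smul_eq_mul] at h1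
    have hae : 0 ≤ᵐ[volume.restrict (Set.Ioc (-(2 * T)) (2 * T))] p :=
      Eventually.of_forall hp0
    have h2 : ∫ u in (-T)..T, p u ≤ ∫ u in (-(2 * T))..2 * T, p u :=
      intervalIntegral.integral_mono_interval (by linarith) (by linarith) (by linarith) hae
        (hpi _ _)
    have h3 : ∫ u in (s - T)..(s - -T), p u ≤ ∫ u in (-(2 * T))..2 * T, p u :=
      intervalIntegral.integral_mono_interval (by linarith) (by linarith) (by linarith) hae
        (hpi _ _)
    rw [le_div_iff₀ hT0]
    linarith

theorem IsC0Group.map_nat_mul {U : ℝ → X →L[ℝ] X} (hU : IsC0Group U) (n : ℕ) (t : ℝ) :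
    U (n * t) = U t ^ n := by
  induction n with
  | zero => simp [hU.map_zero]
  | succ n ih =>
    rw [Nat.cast_succ, add_mul, one_mul, hU.map_add, ih, pow_succ]
    rfl

theorem IsC0Group.exists_growth {U : ℝ → X →L[ℝ] X} (hU : IsC0Group U)
    (hqa : Integrable (fun t : ℝ => Real.log ‖U t‖ / (1 + t ^ 2))) :
    ∃ L : ℕ → ℝ, (∀ m, 0 ≤ L m) ∧ (Summable fun m => L m / 2 ^ m) ∧
      ∀ m s, |s| ≤ 2 ^ m → ‖U s‖ ≤ Real.exp (L m) := by
  obtain ⟨L, hL0, hLs, hL⟩ := exists_dyadic_majorant (p := fun t => Real.posLog ‖U t‖)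
    (fun t => Real.posLog_nonneg)
    (fun s t => (Real.posLog_le_posLog (norm_nonneg _)
      (by rw [hU.map_add]; exact ContinuousLinearMap.opNorm_comp_le _ _)).trans Real.posLog_mul)
    (by
      refine hqa.pos_part.congr (Eventually.of_forall fun t => ?_)
      have h : (0 : ℝ) ≤ 1 + t ^ 2 := by positivity
      simp only [Real.posLog_apply, max_comm (0 : ℝ)]
      rw [← max_div_div_right h, zero_div])
  refine ⟨L, hL0, hLs, fun m s hs => ?_⟩
  rcases (norm_nonneg (U s)).eq_or_lt with h0 | h0
  · rw [← h0]; exact (Real.exp_pos _).le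
  · rw [← Real.log_le_iff_le_exp h0]
    exact (le_max_right _ _).trans (hL m s hs)

/-- An averaging kernel of exponential type one adapted to the growth of the group. -/
theorem IsC0Group.exists_kernel {U : ℝ → X →L[ℝ] X} (hU : IsC0Group U)
    (hqa : Integrable (fun t : ℝ => Real.log ‖U t‖ / (1 + t ^ 2))) (k : ℕ) :
    ∃ (K : ℕ → ℝ → ℝ) (M : ℝ → ℝ) (C : ℝ), 0 < C ∧
      (∀ n t, HasDerivAt (K n) (K (n + 1) t) t) ∧ ∫ t, K 0 t = 1 ∧ (∀ t, 1 ≤ M t) ∧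
      (∀ s t, |s| ≤ |t| → ‖U s‖ ≤ M t) ∧
      ∀ n t, |K n t| * ((1 + |t|) * M t) ^ k ≤ C * (1 + t ^ 2)⁻¹ := by
  obtain ⟨L, hL0, hLs, hL⟩ := hU.exists_growth hqa
  set q : ℕ → ℕ := fun m => ⌈k * L m⌉₊ + (k + 2) * (m + 1) with hq
  have hqle : ∀ m, (q m : ℝ) ≤ k * L m + ((k + 2) * m + (k + 3)) := fun m => by
    have := (Nat.ceil_lt_add_one (mul_nonneg (Nat.cast_nonneg k) (hL0 m))).le
    simp only [hq]
    push_cast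
    linarith
  have hgeom : Summable fun m : ℕ => ((2 : ℝ) ^ m)⁻¹ := by
    simpa using summable_geometric_two
  have hlin : Summable fun m : ℕ => (m : ℝ) * ((2 : ℝ) ^ m)⁻¹ := by
    have := summable_pow_mul_geometric_of_norm_lt_one 1 (r := (1 / 2 : ℝ)) (by norm_num)
    simpa using this
  have hqs : Summable fun m => (q m : ℝ) / 2 ^ m := by
    refine Summable.of_nonneg_of_le (fun m => by positivity) (fun m => ?_)
      ((hLs.mul_left (k : ℝ)).add ((hlin.mul_left (k + 2 : ℝ)).add (hgeom.mul_left (k + 3 : ℝ))))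
    refine (div_le_div_of_nonneg_right (hqle m) (by positivity)).trans (le_of_eq ?_)
    ring
  obtain ⟨K, C, hC, hK, hK1, hKC⟩ := _root_.exists_kernel hqs fun m => by
    simp only [hq]
    nlinarith [Nat.zero_le ⌈k * L m⌉₊, Nat.zero_le (k * (m + 1))]
  refine ⟨K, fun t => Real.exp (L (dyadicIndex t)), C, hC, hK, hK1,
    fun t => Real.one_le_exp (hL0 _), fun s t hst =>
      hL _ _ (hst.trans (abs_le_two_pow_dyadicIndex t)), fun n t => ?_⟩
  set m := dyadicIndex t with hm
  have h1 : 1 + |t| ≤ Real.exp (m + 1) := by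
    have h2 : (2 : ℝ) ≤ Real.exp 1 := by linarith [Real.add_one_le_exp (1 : ℝ)]
    have h3 : (1 : ℝ) ≤ 2 ^ m := one_le_pow₀ (by norm_num)
    calc 1 + |t| ≤ 2 ^ (m + 1) := by
          rw [pow_succ]; linarith [abs_le_two_pow_dyadicIndex t]
      _ ≤ Real.exp 1 ^ (m + 1) := by gcongr
      _ = _ := by rw [← Real.exp_nat_mul]; push_cast; ring_nf
  have h2 : ((1 + |t|) * Real.exp (L m)) ^ k ≤ Real.exp (k * (m + 1 + L m)) := by
    calc _ ≤ (Real.exp (m + 1) * Real.exp (L m)) ^ k := by gcongr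
      _ = _ := by rw [← Real.exp_add, ← Real.exp_nat_mul]
  calc |K n t| * ((1 + |t|) * Real.exp (L m)) ^ k
      ≤ C * Real.exp (-(q m : ℝ)) * Real.exp (k * (m + 1 + L m)) :=
        mul_le_mul (hKC n t) h2 (by positivity) (by positivity)
    _ = C * Real.exp (-(q m : ℝ) + k * (m + 1 + L m)) := by rw [mul_assoc, ← Real.exp_add]
    _ ≤ C * Real.exp (-(2 * (m + 1 : ℝ))) := by
        gcongr
        have := Nat.le_ceil (k * L m)
        simp only [hq]
        push_cast
        linarith
    _ ≤ C * (1 + t ^ 2)⁻¹ := by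
        gcongr
        exact exp_neg_two_mul_le t

theorem inv_one_add_sq_sub_le (u a : ℝ) :
    (1 + (u - a) ^ 2)⁻¹ ≤ 2 * (1 + a ^ 2) * (1 + u ^ 2)⁻¹ := by
  rw [← div_eq_mul_inv, inv_eq_one_div, div_le_div_iff₀ (by positivity) (by positivity)]
  nlinarith [sq_nonneg (u - 2 * a), sq_nonneg (a * (u - a)), sq_nonneg (u - a), sq_nonneg a]

theorem IsC0Group.norm_smul_le {U : ℝ → X →L[ℝ] X} {g : ℝ → ℝ} {l D : ℝ}
    (hD : ∀ t, |g t| * ‖U (l * t)‖ ≤ D * (1 + t ^ 2)⁻¹) (x : X) (t : ℝ) :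
    ‖g t • U (l * t) x‖ ≤ D * (1 + t ^ 2)⁻¹ * ‖x‖ := by
  rw [norm_smul, Real.norm_eq_abs]
  calc |g t| * ‖U (l * t) x‖ ≤ |g t| * (‖U (l * t)‖ * ‖x‖) := by
        gcongr; exact (U (l * t)).le_opNorm x
    _ = |g t| * ‖U (l * t)‖ * ‖x‖ := by ring
    _ ≤ _ := mul_le_mul_of_nonneg_right (hD t) (norm_nonneg x)

theorem IsC0Group.integrable_smul {U : ℝ → X →L[ℝ] X} (hU : IsC0Group U) {g : ℝ → ℝ} {l D : ℝ}
    (hg : Continuous g) (hD : ∀ t, |g t| * ‖U (l * t)‖ ≤ D * (1 + t ^ 2)⁻¹) (x : X) :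
    Integrable fun t => g t • U (l * t) x :=
  ((integrable_inv_one_add_sq.const_mul D).mul_const ‖x‖).mono'
    (hg.smul ((hU.cont x).comp (continuous_const.mul continuous_id))).aestronglyMeasurable
    (Eventually.of_forall (IsC0Group.norm_smul_le hD x))

/-- Averages of orbits are differentiable along the group when the kernel is. -/
theorem IsC0Group.hasDerivAt_average {U : ℝ → X →L[ℝ] X} (hU : IsC0Group U) {g g' : ℝ → ℝ}
    {l D B : ℝ} (hl : 0 < l) (hgg : ∀ t, HasDerivAt g (g' t) t) (hg' : Continuous g')
    (hB : ∀ s, |s| ≤ 1 → ‖U s‖ ≤ B)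
    (hD : ∀ t, |g t| * ‖U (l * t)‖ ≤ D * (1 + t ^ 2)⁻¹)
    (hD' : ∀ t, |g' t| * ‖U (l * t)‖ ≤ D * (1 + t ^ 2)⁻¹) (x : X) (s : ℝ) :
    HasDerivAt (fun t => U t (∫ u, g u • U (l * u) x))
      (U s ((-l⁻¹) • ∫ u, g' u • U (l * u) x)) s := by
  have hg : Continuous g := continuous_iff_continuousAt.2 fun t => (hgg t).continuousAt
  have hB0 : 0 ≤ B := (norm_nonneg _).trans (hB 0 (by simp))
  have hD0 : 0 ≤ D := by
    have := (mul_nonneg (abs_nonneg (g 0)) (norm_nonneg (U (l * 0)))).trans (hD 0)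
    simpa using this
  have hUx : Continuous fun u => U (l * u) x :=
    (hU.cont x).comp (continuous_const.mul continuous_id)
  have hshift : ∀ t, U t (∫ u, g u • U (l * u) x) = ∫ u, g (u - t * l⁻¹) • U (l * u) x := by
    intro t
    rw [← (U t).integral_comp_comm (hU.integrable_smul hg hD x),
      ← integral_add_right_eq_self (fun u => g (u - t * l⁻¹) • U (l * u) x) (t * l⁻¹)]
    refine integral_congr_ae (Eventually.of_forall fun u => ?_)
    simp only [add_sub_cancel_right, map_smul]
    rw [show l * (u + t * l⁻¹) = t + l * u by field_simp; ring, hU.map_add]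
    rfl
  have hzero : HasDerivAt (fun t => U t (∫ u, g u • U (l * u) x))
      ((-l⁻¹) • ∫ u, g' u • U (l * u) x) 0 := by
    simp only [hshift]
    have hder := (hasDerivAt_integral_of_dominated_loc_of_deriv_le (μ := volume) (𝕜 := ℝ)
      (s := Metric.ball (0 : ℝ) 1) (x₀ := (0 : ℝ))
      (F := fun t u => g (u - t * l⁻¹) • U (l * u) x)
      (F' := fun t u => (-l⁻¹ * g' (u - t * l⁻¹)) • U (l * u) x)
      (bound := fun u => l⁻¹ * (D * (2 * (1 + l⁻¹ ^ 2) * (1 + u ^ 2)⁻¹) * B * ‖x‖))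
      (Metric.ball_mem_nhds _ one_pos)
      (Eventually.of_forall fun t =>
        ((hg.comp (continuous_id.sub continuous_const)).smul hUx).aestronglyMeasurable)
      (by simpa using hU.integrable_smul hg hD x)
      (((hg'.comp (continuous_id.sub continuous_const)).const_mul _).smul
        hUx).aestronglyMeasurable
      (Eventually.of_forall fun u t ht => ?_)
      ?_ (Eventually.of_forall fun u t _ => ?_)).2
    · refine hder.congr_deriv ?_
      simp only [zero_mul, sub_zero, mul_smul]
      exact integral_smul _ _
    · rw [mem_ball_zero_iff, Real.norm_eq_abs] at ht
      have hsplit : ‖U (l * u)‖ ≤ ‖U (l * (u - t * l⁻¹))‖ * B := by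
        have hlu : l * u = l * (u - t * l⁻¹) + t := by field_simp; ring
        calc ‖U (l * u)‖ = ‖U (l * (u - t * l⁻¹)) ∘L U t‖ := by rw [← hU.map_add, ← hlu]
          _ ≤ ‖U (l * (u - t * l⁻¹))‖ * ‖U t‖ := ContinuousLinearMap.opNorm_comp_le _ _
          _ ≤ ‖U (l * (u - t * l⁻¹))‖ * B := by gcongr; exact hB t ht.le
      have hsq : (t * l⁻¹) ^ 2 ≤ l⁻¹ ^ 2 := by
        rw [mul_pow]
        exact mul_le_of_le_one_left (by positivity) ((sq_le_one_iff_abs_le_one t).2 ht.le)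
      rw [norm_smul, Real.norm_eq_abs, abs_mul, abs_neg, abs_of_pos (inv_pos.2 hl), mul_assoc]
      refine mul_le_mul_of_nonneg_left ?_ (inv_pos.2 hl).le
      calc |g' (u - t * l⁻¹)| * ‖U (l * u) x‖
          ≤ |g' (u - t * l⁻¹)| * (‖U (l * (u - t * l⁻¹))‖ * B * ‖x‖) := by
            gcongr
            exact ((U (l * u)).le_opNorm x).trans
              (mul_le_mul_of_nonneg_right hsplit (norm_nonneg x))
        _ = |g' (u - t * l⁻¹)| * ‖U (l * (u - t * l⁻¹))‖ * B * ‖x‖ := by ring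
        _ ≤ D * (1 + (u - t * l⁻¹) ^ 2)⁻¹ * B * ‖x‖ :=
            mul_le_mul_of_nonneg_right (mul_le_mul_of_nonneg_right (hD' _) hB0) (norm_nonneg x)
        _ ≤ D * (2 * (1 + l⁻¹ ^ 2) * (1 + u ^ 2)⁻¹) * B * ‖x‖ := by
            gcongr
            refine (inv_one_add_sq_sub_le u (t * l⁻¹)).trans ?_
            gcongr
    · exact ((((integrable_inv_one_add_sq.const_mul _).const_mul D).mul_const B).mul_const
        ‖x‖).const_mul l⁻¹
    · refine HasDerivAt.smul_const ?_ _
      have h1 : HasDerivAt (fun t : ℝ => u - t * l⁻¹) (-l⁻¹) t := by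
        simpa using ((hasDerivAt_id t).mul_const l⁻¹).const_sub u
      have h2 := (hgg (u - t * l⁻¹)).comp t h1
      rw [mul_comm] at h2
      exact h2
  have hsub : HasDerivAt (fun t : ℝ => t - s) 1 s := (hasDerivAt_id s).sub_const s
  rw [← sub_self s] at hzero
  have hcomp := HasDerivAt.scomp (h := fun t : ℝ => t - s) s hzero hsub
  rw [one_smul] at hcomp
  refine ((U s).hasFDerivAt.comp_hasDerivAt s hcomp).congr_of_eventuallyEq
    (Eventually.of_forall fun t => ?_)
  simp only [Function.comp]
  rw [← ContinuousLinearMap.comp_apply, ← hU.map_add, add_sub_cancel]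

/-- Entire vectors whose iterates under the generator satisfy a sharp geometric bound. -/
def GeomBounded (U : ℝ → X →L[ℝ] X) (r : ℝ) (y : X) : Prop :=
  ∃ (xs : ℕ → X) (c : ℝ), 0 ≤ c ∧ xs 0 = y ∧ GenChain U xs ∧ ∀ n, ‖xs n‖ ≤ c * r ^ n

theorem GeomBounded.zero (U : ℝ → X →L[ℝ] X) (r : ℝ) : GeomBounded U r 0 :=
  ⟨fun _ => 0, 0, le_rfl, rfl, fun n s => by simpa using hasDerivAt_const s (0 : X), by simp⟩

theorem GeomBounded.add {U : ℝ → X →L[ℝ] X} {r : ℝ} {y z : X} (hy : GeomBounded U r y)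
    (hz : GeomBounded U r z) : GeomBounded U r (y + z) := by
  obtain ⟨ys, c, hc, rfl, hys, hyb⟩ := hy
  obtain ⟨zs, d, hd, rfl, hzs, hzb⟩ := hz
  refine ⟨fun n => ys n + zs n, c + d, add_nonneg hc hd, rfl, fun n s => ?_, fun n => ?_⟩
  · simpa only [map_add] using (hys n s).fun_add (hzs n s)
  · rw [add_mul]
    exact (norm_add_le _ _).trans (add_le_add (hyb n) (hzb n))

theorem GeomBounded.smul {U : ℝ → X →L[ℝ] X} {r : ℝ} {y : X} (hy : GeomBounded U r y) (a : ℝ) :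
    GeomBounded U r (a • y) := by
  obtain ⟨ys, c, hc, rfl, hys, hyb⟩ := hy
  refine ⟨fun n => a • ys n, |a| * c, by positivity, rfl, fun n s => ?_, fun n => ?_⟩
  · simpa only [map_smul] using (hys n s).fun_const_smul a
  · rw [norm_smul, Real.norm_eq_abs, mul_assoc]
    exact mul_le_mul_of_nonneg_left (hyb n) (abs_nonneg a)

theorem GeomBounded.sum {ι : Type*} {U : ℝ → X →L[ℝ] X} {r : ℝ} {y : ι → X} (s : Finset ι)
    (hy : ∀ i ∈ s, GeomBounded U r (y i)) : GeomBounded U r (∑ i ∈ s, y i) :=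
  Finset.sum_induction y (GeomBounded U r) (fun _ _ => GeomBounded.add) (GeomBounded.zero U r) hy

theorem GeomBounded.expTypeLe {U : ℝ → X →L[ℝ] X} {r : ℝ} {y : X} (hr : 0 ≤ r)
    (hy : GeomBounded U r y) : ExpTypeLe U y r := by
  obtain ⟨xs, c, hc, h0, hxs, hb⟩ := hy
  refine ⟨xs, h0, hxs, fun ρ hρ => ⟨c + 1, by linarith, fun n => (hb n).trans ?_⟩⟩
  gcongr
  linarith

theorem IsC0Group.geomBounded_average {U : ℝ → X →L[ℝ] X} (hU : IsC0Group U) {K : ℕ → ℝ → ℝ}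
    {l r D B : ℝ} (hl : 0 < l) (hlr : l⁻¹ ≤ r) (hK : ∀ n t, HasDerivAt (K n) (K (n + 1) t) t)
    (hB : ∀ s, |s| ≤ 1 → ‖U s‖ ≤ B)
    (hD : ∀ n t, |K n t| * ‖U (l * t)‖ ≤ D * (1 + t ^ 2)⁻¹) (x : X) :
    GeomBounded U r (∫ u, K 0 u • U (l * u) x) := by
  have hc : ∀ n, Continuous (K n) := fun n =>
    continuous_iff_continuousAt.2 fun t => (hK n t).continuousAt
  have hbound : ∀ n, ‖∫ u, K n u • U (l * u) x‖ ≤ ∫ u : ℝ, D * (1 + u ^ 2)⁻¹ * ‖x‖ := fun n =>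
    norm_integral_le_of_norm_le ((integrable_inv_one_add_sq.const_mul D).mul_const ‖x‖)
      (Eventually.of_forall (IsC0Group.norm_smul_le (hD n) x))
  refine ⟨fun n => (-l⁻¹) ^ n • ∫ u, K n u • U (l * u) x, ∫ u : ℝ, D * (1 + u ^ 2)⁻¹ * ‖x‖,
    (norm_nonneg _).trans (hbound 0), by simp, fun n s => ?_, fun n => ?_⟩
  · have := (hU.hasDerivAt_average hl (hK n) (hc (n + 1)) hB (hD n) (hD (n + 1)) x
      s).fun_const_smul ((-l⁻¹) ^ n)
    simpa only [pow_succ, mul_smul, map_smul] using this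
  · rw [norm_smul, norm_pow, norm_neg, Real.norm_eq_abs, abs_of_pos (inv_pos.2 hl), mul_comm]
    have := inv_pos.2 hl
    gcongr
    · exact (norm_nonneg _).trans (hbound n)
    · exact hbound n

theorem norm_sub_one_pow_le_symModulus {U : ℝ → X →L[ℝ] X} {k : ℕ} (hk : 1 ≤ k) {B t τ : ℝ}
    (hB : ∀ s, |s| ≤ t → ‖U s‖ ≤ B) (hτ : |τ| ≤ t) (x : X) :
    ‖((U τ - 1) ^ k) x‖ ≤ symModulus U k t x := by
  refine le_csSup ⟨(B + ‖(1 : X →L[ℝ] X)‖) ^ k * ‖x‖, ?_⟩ ⟨τ, hτ, rfl⟩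
  rintro _ ⟨s, hs, rfl⟩
  refine (ContinuousLinearMap.le_opNorm _ x).trans ?_
  gcongr
  refine (norm_pow_le' _ hk).trans ?_
  gcongr
  exact (norm_sub_le _ _).trans (by gcongr; exact hB s hs)

theorem IsC0Group.norm_sub_one_pow_le {U : ℝ → X →L[ℝ] X} (hU : IsC0Group U) {M : ℝ → ℝ}
    (hM : ∀ s t, |s| ≤ |t| → ‖U s‖ ≤ M t) {k : ℕ} (hk : 1 ≤ k) {r : ℝ} (hr : 1 ≤ r) (x : X)
    (u : ℝ) :
    ‖((U (r⁻¹ * u) - 1) ^ k) x‖ ≤ ((1 + |u|) * M u) ^ k * symModulus U k (1 / r) x := by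
  set N := ⌊|u|⌋₊ + 1 with hN
  have hr0 : 0 < r := by linarith
  have hN0 : (0 : ℝ) < N := by positivity
  have hNu : (N : ℝ) ≤ 1 + |u| := by
    have := Nat.floor_le (abs_nonneg u)
    rw [hN]; push_cast; linarith
  have huN : |u| ≤ N := by
    rw [hN]; push_cast; exact (Nat.lt_floor_add_one _).le
  have hM0 : 0 ≤ M u := (norm_nonneg _).trans (hM 0 u (by simp))
  set τ := r⁻¹ * u / N with hτ
  have hτN : (N : ℝ) * τ = r⁻¹ * u := mul_div_cancel₀ _ hN0.ne'
  have hτ1 : |τ| ≤ 1 / r := by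
    rw [hτ, abs_div, abs_mul, abs_of_pos (inv_pos.2 hr0), abs_of_pos hN0, div_le_iff₀ hN0,
      one_div]
    gcongr
  have hτu : (N : ℝ) * |τ| ≤ |u| := by
    rw [← abs_of_pos hN0, ← abs_mul, hτN, abs_mul, abs_of_pos (inv_pos.2 hr0)]
    exact mul_le_of_le_one_left (abs_nonneg u) (inv_le_one_of_one_le₀ hr)
  set S := ∑ i ∈ Finset.range N, U τ ^ i with hS
  have hSn : ‖S‖ ≤ (1 + |u|) * M u := by
    calc ‖S‖ ≤ ∑ i ∈ Finset.range N, M u := by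
          refine norm_sum_le_of_le _ fun i hi => ?_
          rw [← hU.map_nat_mul]
          refine hM _ _ (le_trans ?_ hτu)
          rw [abs_mul, Nat.abs_cast]
          gcongr
          exact (Finset.mem_range.1 hi).le
      _ = N * M u := by simp
      _ ≤ (1 + |u|) * M u := by gcongr
  have hcomm : Commute S (U τ - 1) := by
    rw [Commute, SemiconjBy, hS, geom_sum_mul, mul_geom_sum]
  rw [← hτN, hU.map_nat_mul, ← geom_sum_mul, ← hS, hcomm.mul_pow]
  calc ‖(S ^ k) (((U τ - 1) ^ k) x)‖ ≤ ‖S ^ k‖ * ‖((U τ - 1) ^ k) x‖ :=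
        ContinuousLinearMap.le_opNorm _ _
    _ ≤ ((1 + |u|) * M u) ^ k * symModulus U k (1 / r) x := by
        refine mul_le_mul ((norm_pow_le' S hk).trans (by gcongr)) ?_ (norm_nonneg _) (by positivity)
        refine norm_sub_one_pow_le_symModulus hk (B := M 1) (fun s hs => hM s 1 ?_) hτ1 x
        rw [abs_one]
        exact hs.trans ((div_le_one hr0).2 hr)

theorem IsC0Group.sub_one_pow_apply {U : ℝ → X →L[ℝ] X} (hU : IsC0Group U) (k : ℕ) (t : ℝ)
    (x : X) : ((U t - 1) ^ k) x
      = ∑ j ∈ Finset.range (k + 1), ((-1) ^ (k - j) * (k.choose j : ℝ)) • U (j * t) x := by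
  have hc : Commute (U t) (-1) := (Commute.one_right _).neg_right
  rw [sub_eq_add_neg, hc.add_pow, sum_apply]
  refine Finset.sum_congr rfl fun j _ => ?_
  rw [hU.map_nat_mul]
  have h1 : (-1 : X →L[ℝ] X) ^ (k - j) = ((-1 : ℝ) ^ (k - j)) • 1 := by
    rcases Nat.even_or_odd (k - j) with he | he
    · rw [he.neg_one_pow, he.neg_one_pow, one_smul]
    · rw [he.neg_one_pow, he.neg_one_pow, neg_smul, one_smul]
  have h2 : ((k.choose j : ℕ) : X →L[ℝ] X) = (k.choose j : ℝ) • 1 := by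
    rw [Nat.cast_smul_eq_nsmul, nsmul_one]
  rw [h1, h2, mul_smul_comm, mul_one, mul_smul_comm, mul_one, smul_smul, mul_comm]
  rfl

/-- Abstract Jackson inequality: for a non-quasianalytic C₀-group U with
generator A, for every k ∈ ℕ there is a constant m_k > 0 such that
E_r(x,A) ≤ m_k · ω̃_k(1/r, x, A) for all x ∈ X and r ≥ 1. -/
theorem stmt_17 {X : Type*} [NormedAddCommGroup X] [NormedSpace ℝ X] [CompleteSpace X]
    (U : ℝ → X →L[ℝ] X) (hU : IsC0Group U)
    (hqa : Integrable (fun t : ℝ => Real.log ‖U t‖ / (1 + t ^ 2))) :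
    ∀ k : ℕ, 1 ≤ k → ∃ m : ℝ, 0 < m ∧
      ∀ (x : X) (r : ℝ), 1 ≤ r →
        bestApprox U x r ≤ m * symModulus U k (1 / r) x := by
  intro k hk
  obtain ⟨K, M, C, hC, hK, hK1, hM1, hM, hKC⟩ := hU.exists_kernel hqa k
  refine ⟨C * Real.pi, by positivity, fun x r hr => ?_⟩
  have hr0 : 0 < r := by linarith
  have hK0 : Continuous (K 0) := continuous_iff_continuousAt.2 fun t => (hK 0 t).continuousAt
  have hbd : ∀ j ≤ k, ∀ n u, |K n u| * ‖U (j * r⁻¹ * u)‖ ≤ C * (1 + u ^ 2)⁻¹ := by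
    intro j hj n u
    refine le_trans (mul_le_mul_of_nonneg_left ?_ (abs_nonneg _)) (hKC n u)
    have hone : 1 ≤ (1 + |u|) * M u := one_le_mul_of_one_le_of_one_le (by simp) (hM1 u)
    have hMle : M u ≤ (1 + |u|) * M u :=
      le_mul_of_one_le_left (zero_le_one.trans (hM1 u)) (by simp)
    have hle : ‖U (r⁻¹ * u)‖ ≤ (1 + |u|) * M u := by
      refine (hM _ u ?_).trans hMle
      rw [abs_mul, abs_of_pos (inv_pos.2 hr0)]
      exact mul_le_of_le_one_left (abs_nonneg u) (inv_le_one_of_one_le₀ hr)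
    rcases Nat.eq_zero_or_pos j with rfl | hj0
    · refine ((hM _ u (by simp)).trans hMle).trans (le_self_pow₀ hone (by omega))
    · rw [mul_assoc, hU.map_nat_mul]
      exact (norm_pow_le' _ hj0).trans
        ((pow_le_pow_left₀ (norm_nonneg _) hle j).trans (pow_le_pow_right₀ hone hj))
  set V := ∫ u, K 0 u • ((U (r⁻¹ * u) - 1) ^ k) x
  have hVle : ‖V‖ ≤ C * Real.pi * symModulus U k (1 / r) x := by
    have hs : 0 ≤ symModulus U k (1 / r) x :=
      Real.sSup_nonneg (by rintro _ ⟨τ, _, rfl⟩; exact norm_nonneg _)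
    calc ‖V‖ ≤ ∫ u : ℝ, C * (1 + u ^ 2)⁻¹ * symModulus U k (1 / r) x := by
          refine norm_integral_le_of_norm_le
            ((integrable_inv_one_add_sq.const_mul C).mul_const _)
            (Eventually.of_forall fun u => ?_)
          rw [norm_smul, Real.norm_eq_abs]
          refine (mul_le_mul_of_nonneg_left (hU.norm_sub_one_pow_le hM hk hr x u)
            (abs_nonneg _)).trans ?_
          rw [← mul_assoc]
          exact mul_le_mul_of_nonneg_right (hKC 0 u) hs
      _ = _ := by
          rw [integral_mul_const, integral_const_mul, integral_univ_inv_one_add_sq]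
  set Y : ℕ → X := fun j => ∫ u, K 0 u • U (j * r⁻¹ * u) x with hY
  set c : ℕ → ℝ := fun j => (-1) ^ (k - j) * (k.choose j : ℝ) with hc
  have hVY : V = ∑ j ∈ Finset.range (k + 1), c j • Y j := by
    simp only [hY, ← integral_smul]
    rw [← integral_finsetSum]
    · refine integral_congr_ae (Eventually.of_forall fun u => ?_)
      simp only [hU.sub_one_pow_apply, Finset.smul_sum]
      refine Finset.sum_congr rfl fun j _ => ?_
      rw [smul_comm, mul_assoc]
    · intro j hj
      exact (hU.integrable_smul hK0
        (hbd j (Nat.lt_succ_iff.1 (Finset.mem_range.1 hj)) 0) x).smul (c j)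
  have hY0 : Y 0 = x := by
    simp [hY, hU.map_zero, integral_smul_const, hK1]
  have hsgn : ((-1 : ℝ) ^ k) * (-1) ^ k = 1 := by rw [← mul_pow]; norm_num
  have hxV : x - (-1 : ℝ) ^ k • V
      = (-(-1 : ℝ) ^ k) • ∑ j ∈ Finset.range k, c (j + 1) • Y (j + 1) := by
    have hc0 : c 0 = (-1) ^ k := by simp [hc]
    rw [hVY, Finset.sum_range_succ', hY0, hc0, smul_add, smul_smul, hsgn, one_smul, neg_smul]
    abel
  have hy : ExpTypeLe U (x - (-1 : ℝ) ^ k • V) r := by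
    refine GeomBounded.expTypeLe hr0.le ?_
    rw [hxV]
    refine GeomBounded.smul (GeomBounded.sum _ fun j hj => GeomBounded.smul ?_ _) _
    refine hU.geomBounded_average (by positivity) ?_ hK (fun s hs => hM s 1 (by simpa using hs))
      (hbd (j + 1) (Finset.mem_range.1 hj)) x
    rw [mul_inv, inv_inv]
    exact mul_le_of_le_one_left hr0.le (inv_le_one_of_one_le₀ (by simp))
  have hle : bestApprox U x r ≤ ‖x - (x - (-1 : ℝ) ^ k • V)‖ := by
    refine csInf_le ⟨0, ?_⟩ ⟨_, hy, rfl⟩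
    rintro _ ⟨y, _, rfl⟩
    exact norm_nonneg _
  rw [sub_sub_cancel, norm_smul] at hle
  refine le_trans ?_ hVle
  simpa using hle
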